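/- If b, m, n are positive integers not divisible by p, and c = b·p^r where r ≥ j + k, then σ_{ψ,ε}(m,n;c) = ψ(m)·conj(ψ(n))·φ(p^j)·S_{ψ̄²}(m,n;c). -/

import Mathlib

open Complex Finset

noncomputable def eZMod (c : ℕ) (z : ZMod c) : ℂ :=
  Complex.exp (2 * Real.pi * Complex.I * (z.val : ℂ) / (c : ℂ))

/-- Ordinary Kloosterman sum `S(m,n;c)`. -/
noncomputable def klooOrd (c : ℕ) [NeZero c] (m n : ZMod c) : ℂ :=
  ∑ x : (ZMod c)ˣ, eZMod c (m * (x : ZMod c) + n * ((x⁻¹ : (ZMod c)ˣ) : ZMod c))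

/-- `S_{χ̄²}(m,n;c) = ∑_{x mod c, (x,c)=1} χ(x)² e_c(mx + n x̄)`, where `χ` is a character
modulo `q` with `q ∣ c` and is evaluated at `x mod q`. -/
noncomputable def SChiSq (q c : ℕ) [NeZero c] (h : q ∣ c) (χ : DirichletCharacter ℂ q)
    (m n : ZMod c) : ℂ :=
  ∑ x : (ZMod c)ˣ, (χ (ZMod.castHom h (ZMod q) (x : ZMod c)))^2 *
    eZMod c (m * (x : ZMod c) + n * ((x⁻¹ : (ZMod c)ˣ) : ZMod c))

/-- The coset sum `σ_{ψ,ε}(m,n;c)`: the sum over the Dirichlet characters `χ` modulo `p^k`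
in the coset `ψ·Ĝ_{p^j}` of `χ(m)·conj(χ(n))·(1 + ε·χ(-1))·S_{χ̄²}(m,n;c)`. -/
noncomputable def cosetSum (p k j : ℕ) (hjk : j ≤ k) (ψ : DirichletCharacter ℂ (p^k))
    (ε : ℤ) (c : ℕ) [NeZero c] (hqc : p^k ∣ c) (m n : ZMod c) : ℂ :=
  ∑ χ' : DirichletCharacter ℂ (p^j),
    (ψ * DirichletCharacter.changeLevel (pow_dvd_pow p hjk) χ')
        (ZMod.castHom hqc (ZMod (p^k)) m) *
    (starRingEnd ℂ) ((ψ * DirichletCharacter.changeLevel (pow_dvd_pow p hjk) χ')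
        (ZMod.castHom hqc (ZMod (p^k)) n)) *
    (1 + (ε : ℂ) * (ψ * DirichletCharacter.changeLevel (pow_dvd_pow p hjk) χ') (-1)) *
    SChiSq (p^k) c hqc (ψ * DirichletCharacter.changeLevel (pow_dvd_pow p hjk) χ') m n

/-- The sums `K_ψ^±(m,n;p^r)` (the sign `±` is the parameter `s`): the sum of
`ψ(x)² e_{p^r}(mx + n x̄)` over `x mod p^r`, `p ∤ x`, with `m x² ≡ s·n (mod p^j)`. -/
noncomputable def Kpm (p k j r : ℕ) [NeZero (p^r)] (hkr : k ≤ r) (hjr : j ≤ r)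
    (ψ : DirichletCharacter ℂ (p^k)) (s : ℤ) (m n : ZMod (p^r)) : ℂ :=
  ∑ x ∈ Finset.univ.filter (fun x : (ZMod (p^r))ˣ =>
      ZMod.castHom (pow_dvd_pow p hjr) (ZMod (p^j)) (m * (x : ZMod (p^r))^2)
        = (s : ZMod (p^j)) * ZMod.castHom (pow_dvd_pow p hjr) (ZMod (p^j)) n),
    (ψ (ZMod.castHom (pow_dvd_pow p hkr) (ZMod (p^k)) (x : ZMod (p^r))))^2 *
      eZMod (p^r) (m * (x : ZMod (p^r)) + n * ((x⁻¹ : (ZMod (p^r))ˣ) : ZMod (p^r)))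

theorem eZMod_eq_stdAddChar (c : ℕ) [NeZero c] (z : ZMod c) :
    eZMod c z = ZMod.stdAddChar z := by
  rw [ZMod.stdAddChar_apply, ZMod.toCircle_apply]
  rfl

theorem eZMod_add (c : ℕ) [NeZero c] (y z : ZMod c) :
    eZMod c (y + z) = eZMod c y * eZMod c z := by
  simp only [eZMod_eq_stdAddChar, AddChar.map_add_eq_mul]

theorem eq_zero_of_eZMod_eq_one (c : ℕ) [NeZero c] (z : ZMod c) (h : eZMod c z = 1) :
    z = 0 := by
  rw [eZMod_eq_stdAddChar, ← AddChar.map_zero_eq_one (ZMod.stdAddChar (N := c))] at h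
  exact ZMod.injective_stdAddChar h

/-- A twisted Kloosterman sum vanishes if its weight is invariant under multiplication by `1 + d`,
where `d ^ 2 = 0`, and is supported off the stationary points `d * (m * x - n * x⁻¹) = 0`. -/
theorem sum_mul_eZMod_eq_zero (c : ℕ) [NeZero c] (m n d : ZMod c) (hd : d * d = 0)
    (u : (ZMod c)ˣ) (hu : (u : ZMod c) = 1 + d) (hu' : ((u⁻¹ : (ZMod c)ˣ) : ZMod c) = 1 - d)
    (a : (ZMod c)ˣ → ℂ) (ha : ∀ x, a (x * u) = a x)
    (h0 : ∀ x : (ZMod c)ˣ,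
      d * (m * (x : ZMod c) - n * ((x⁻¹ : (ZMod c)ˣ) : ZMod c)) = 0 → a x = 0) :
    ∑ x : (ZMod c)ˣ,
      a x * eZMod c (m * (x : ZMod c) + n * ((x⁻¹ : (ZMod c)ˣ) : ZMod c)) = 0 := by
  set ζ : (ZMod c)ˣ → ℂ := fun x =>
    eZMod c (d * (m * (x : ZMod c) - n * ((x⁻¹ : (ZMod c)ˣ) : ZMod c))) with hζ
  set h : (ZMod c)ˣ → ℂ := fun x =>
    a x * eZMod c (m * (x : ZMod c) + n * ((x⁻¹ : (ZMod c)ˣ) : ZMod c)) with hh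
  have hζu : ∀ x, ζ (x * u) = ζ x := by
    intro x
    simp only [hζ, mul_inv, Units.val_mul, hu, hu']
    congr 1
    linear_combination (m * (x : ZMod c) + n * ((x⁻¹ : (ZMod c)ˣ) : ZMod c)) * hd
  have hhu : ∀ x, h (x * u) = h x * ζ x := by
    intro x
    simp only [hζ, hh, ha, mul_inv, Units.val_mul, hu, hu', mul_assoc, ← eZMod_add]
    congr 2
    ring
  have key : ∀ x, h x = h (x * u) / (ζ (x * u) - 1) - h x / (ζ x - 1) := by
    intro x
    rw [hζu, hhu]
    by_cases h1 : ζ x = 1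
    · have : h x = 0 := by
        simp only [hh, h0 x (eq_zero_of_eZMod_eq_one c _ h1), zero_mul]
      simp [this]
    · have : ζ x - 1 ≠ 0 := sub_ne_zero.mpr h1
      field_simp
  change ∑ x, h x = 0
  rw [Finset.sum_congr rfl fun x _ => key x, Finset.sum_sub_distrib,
    sub_eq_zero]
  exact Equiv.sum_comp (Equiv.mulRight u) fun x => h x / (ζ x - 1)

theorem castHom_eq_zero_of_mul_eq_zero (p b j r c : ℕ) [NeZero c] (hp : 0 < p) (hb : 0 < b)
    (hjr : j ≤ r) (hc : c = b * p ^ r) (hjc : p ^ j ∣ c) (y : ZMod c)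
    (hy : ((b * p ^ (r - j) : ℕ) : ZMod c) * y = 0) :
    ZMod.castHom hjc (ZMod (p ^ j)) y = 0 := by
  rw [← ZMod.natCast_zmod_val y] at hy ⊢
  rw [map_natCast, ZMod.natCast_eq_zero_iff]
  rw [← Nat.cast_mul, ZMod.natCast_eq_zero_iff] at hy
  have hc' : c = b * p ^ (r - j) * p ^ j := by
    rw [hc, mul_assoc, ← pow_add, Nat.sub_add_cancel hjr]
  exact Nat.dvd_of_mul_dvd_mul_left (k := b * p ^ (r - j)) (by positivity) (by rwa [← hc'])

/-- Twisting `ψ` by a character `χ` modulo `p ^ j` does not change the sum, once it is normalized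
by `χ(m) * conj (χ(n))`. -/
theorem mul_SChiSq_mul_changeLevel (p : ℕ) (hp : p.Prime) (k j : ℕ) (hjk : j ≤ k)
    (ψ : DirichletCharacter ℂ (p ^ k)) (χ : DirichletCharacter ℂ (p ^ j))
    (b m n : ℕ) (hb : 0 < b) (hpn : ¬ p ∣ n)
    (r : ℕ) (hr : j + k ≤ r)
    (c : ℕ) [NeZero c] (hc : c = b * p ^ r) (hqc : p ^ k ∣ c) :
    χ (m : ZMod (p ^ j)) * (starRingEnd ℂ) (χ (n : ZMod (p ^ j))) *
      SChiSq (p ^ k) c hqc (ψ * DirichletCharacter.changeLevel (pow_dvd_pow p hjk) χ) m n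
      = SChiSq (p ^ k) c hqc ψ m n := by
  have hjc : p ^ j ∣ c := (pow_dvd_pow p hjk).trans hqc
  set d : ZMod c := ((b * p ^ (r - j) : ℕ) : ZMod c) with hd_def
  have hd : d * d = 0 := by
    rw [hd_def, ← Nat.cast_mul, ZMod.natCast_eq_zero_iff, hc]
    have : b * p ^ (r - j) * (b * p ^ (r - j)) = b * p ^ (r - j + (r - j)) * b := by
      rw [pow_add]; ring
    rw [this]
    exact Dvd.dvd.mul_right (mul_dvd_mul_left b (pow_dvd_pow p (by omega))) b
  have hdk : ZMod.castHom hqc (ZMod (p ^ k)) d = 0 := by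
    rw [hd_def, map_natCast, ZMod.natCast_eq_zero_iff]
    exact Dvd.dvd.mul_left (pow_dvd_pow p (by omega)) b
  let u : (ZMod c)ˣ := ⟨1 + d, 1 - d, by linear_combination -hd, by linear_combination -hd⟩
  have hcast : ∀ y : ZMod c, ZMod.castHom (pow_dvd_pow p hjk) (ZMod (p ^ j))
      (ZMod.castHom hqc (ZMod (p ^ k)) y) = ZMod.castHom hjc (ZMod (p ^ j)) y := fun y => by
    rw [← RingHom.comp_apply]
    exact congrArg (fun f : ZMod c →+* ZMod (p ^ j) => f y) (Subsingleton.elim _ _)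
  have hlevel : ∀ x : (ZMod c)ˣ, DirichletCharacter.changeLevel (pow_dvd_pow p hjk) χ
      (ZMod.castHom hqc (ZMod (p ^ k)) x) = χ (ZMod.castHom hjc (ZMod (p ^ j)) x) := by
    intro x
    rw [← hcast]
    exact DirichletCharacter.changeLevel_eq_cast_of_dvd χ (pow_dvd_pow p hjk)
      (Units.map (ZMod.castHom hqc (ZMod (p ^ k))).toMonoidHom x)
  have hunit : IsUnit (n : ZMod (p ^ j)) :=
    (ZMod.isUnit_iff_coprime n (p ^ j)).mpr
      (Nat.Coprime.pow_right j ((Nat.Prime.coprime_iff_not_dvd hp).mpr hpn).symm)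
  have hvan := sum_mul_eZMod_eq_zero c m n d hd u rfl rfl
    (fun x => (ψ (ZMod.castHom hqc (ZMod (p ^ k)) x)) ^ 2 *
      (χ m * (starRingEnd ℂ) (χ n) * (χ (ZMod.castHom hjc (ZMod (p ^ j)) x)) ^ 2 - 1))
    (fun x => by
      have h1 : ZMod.castHom hqc (ZMod (p ^ k)) ((x * u : (ZMod c)ˣ) : ZMod c)
          = ZMod.castHom hqc (ZMod (p ^ k)) x := by
        rw [Units.val_mul, map_mul, show (u : ZMod c) = 1 + d from rfl, map_add, hdk, map_one,
          add_zero, mul_one]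
      simp only [← hcast, h1])
    (fun x hx => by
      have h1 := castHom_eq_zero_of_mul_eq_zero p b j r c hp.pos hb (by omega) hc hjc _ hx
      have h2 : (m : ZMod (p ^ j)) * (ZMod.castHom hjc (ZMod (p ^ j)) x) ^ 2 = n := by
        have h3 : ZMod.castHom hjc (ZMod (p ^ j)) ((x⁻¹ : (ZMod c)ˣ) : ZMod c) *
            ZMod.castHom hjc (ZMod (p ^ j)) x = 1 := by
          rw [← map_mul, Units.inv_mul, map_one]
        rw [map_sub, map_mul, map_mul, map_natCast, map_natCast] at h1
        linear_combination ZMod.castHom hjc (ZMod (p ^ j)) x * h1 + n * h3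
      have h4 : χ m * (χ (ZMod.castHom hjc (ZMod (p ^ j)) x)) ^ 2 = χ n := by
        rw [← map_pow, ← map_mul, h2]
      have h5 : χ n * (starRingEnd ℂ) (χ n) = 1 := by
        obtain ⟨v, hv⟩ := hunit
        rw [Complex.mul_conj, Complex.normSq_eq_norm_sq, ← hv, DirichletCharacter.unit_norm_eq_one]
        simp
      have h6 : χ m * (starRingEnd ℂ) (χ n) *
          (χ (ZMod.castHom hjc (ZMod (p ^ j)) x)) ^ 2 - 1 = 0 := by
        linear_combination (starRingEnd ℂ) (χ n) * h4 + h5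
      rw [h6, mul_zero])
  rw [← sub_eq_zero, ← hvan, SChiSq, SChiSq, Finset.mul_sum, ← Finset.sum_sub_distrib]
  refine Finset.sum_congr rfl fun x _ => ?_
  rw [MulChar.mul_apply, hlevel]
  ring

/-- for `c = b·p^r` with `r ≥ j + k`, the coset sum equals
`ψ(m)·conj(ψ(n))·φ(p^j)·S_{ψ̄²}(m,n;c)`. -/
theorem cosetSum_eq_SChiSq (p : ℕ) (hp : p.Prime) (hodd : Odd p)
    (k : ℕ) (hk : 2 ≤ k) (j : ℕ) (hj : 1 ≤ j) (hjk : j < k)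
    (ψ : DirichletCharacter ℂ (p^k)) (hψ : (ψ^2).conductor = p^k)
    (ε : ℤ) (hε : ε = 1 ∨ ε = -1)
    (b m n : ℕ) (hb : 0 < b) (hm : 0 < m) (hn : 0 < n)
    (hpb : ¬ p ∣ b) (hpm : ¬ p ∣ m) (hpn : ¬ p ∣ n)
    (r : ℕ) (hr : j + k ≤ r)
    (c : ℕ) [NeZero c] (hc : c = b * p ^ r) (hqc : p ^ k ∣ c) :
    cosetSum p k j hjk.le ψ ε c hqc (m : ZMod c) (n : ZMod c)
      = ψ (m : ZMod (p^k)) * (starRingEnd ℂ) (ψ (n : ZMod (p^k))) *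
          (Nat.totient (p^j) : ℂ) * SChiSq (p^k) c hqc ψ (m : ZMod c) (n : ZMod c) := by
  have : NeZero (p ^ j) := ⟨pow_ne_zero j hp.ne_zero⟩
  have hneg : (-1 : ZMod (p ^ j)) ≠ 1 := by
    have h2 : 2 < p ^ j := by
      have h3 : p ≠ 2 := by rintro rfl; exact absurd hodd (by decide)
      calc 2 < p := lt_of_le_of_ne hp.two_le h3.symm
        _ ≤ p ^ j := Nat.le_self_pow (by omega) p
    have : Fact (2 < p ^ j) := ⟨h2⟩
    exact ZMod.neg_one_ne_one
  have hunit : ∀ l : ℕ, ¬ p ∣ l → IsUnit (l : ZMod (p ^ k)) := fun l hl =>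
    (ZMod.isUnit_iff_coprime l (p ^ k)).mpr
      (Nat.Coprime.pow_right k ((Nat.Prime.coprime_iff_not_dvd hp).mpr hl).symm)
  have hlevel : ∀ (χ : DirichletCharacter ℂ (p ^ j)) (y : ZMod (p ^ k)), IsUnit y →
      DirichletCharacter.changeLevel (pow_dvd_pow p hjk.le) χ y
        = χ (ZMod.castHom (pow_dvd_pow p hjk.le) (ZMod (p ^ j)) y) := by
    rintro χ _ ⟨v, rfl⟩
    exact DirichletCharacter.changeLevel_eq_cast_of_dvd χ (pow_dvd_pow p hjk.le) v
  have hterm : ∀ χ : DirichletCharacter ℂ (p ^ j),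
      (ψ * DirichletCharacter.changeLevel (pow_dvd_pow p hjk.le) χ)
        (ZMod.castHom hqc (ZMod (p ^ k)) m) *
      (starRingEnd ℂ) ((ψ * DirichletCharacter.changeLevel (pow_dvd_pow p hjk.le) χ)
        (ZMod.castHom hqc (ZMod (p ^ k)) n)) *
      (1 + (ε : ℂ) * (ψ * DirichletCharacter.changeLevel (pow_dvd_pow p hjk.le) χ) (-1)) *
      SChiSq (p ^ k) c hqc (ψ * DirichletCharacter.changeLevel (pow_dvd_pow p hjk.le) χ) m n
      = ψ m * (starRingEnd ℂ) (ψ n) * SChiSq (p ^ k) c hqc ψ m n *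
        (χ 1 + (ε : ℂ) * ψ (-1) * χ (-1)) := by
    intro χ
    rw [← mul_SChiSq_mul_changeLevel p hp k j hjk.le ψ χ b m n hb hpn r hr c hc hqc]
    simp only [MulChar.mul_apply, map_natCast, map_mul, hlevel χ _ (hunit m hpm),
      hlevel χ _ (hunit n hpn), hlevel χ _ isUnit_one.neg, map_neg, map_one]
    ring
  rw [cosetSum, Finset.sum_congr rfl fun χ _ => hterm χ, ← Finset.mul_sum, Finset.sum_add_distrib,
    ← Finset.mul_sum, DirichletCharacter.sum_characters_eq, DirichletCharacter.sum_characters_eq,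
    if_pos rfl, if_neg hneg]
  ring
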